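/- Let d ≥ 2 and let 0 < α < 1. Then there exist disjoint open balls B₊, B₋ ⊂ ℝ^d with |B₊| > |B₋| > 0 such that |B₊ ∪ B₋|^{2/d} λ₁^{χ_α}(B₊ ∪ B₋) < 2^{2/d} |B|^{2/d} λ₁(B), where χ_α is the bang-bang function associated with B₋ and α, and B is the open unit ball of ℝ^d. (The right-hand side equals |B^∧ ∪ B^∨|^{2/d} λ₂(B^∧ ∪ B^∨) for any two disjoint balls B^∧, B^∨ of equal measure, since the second Dirichlet eigenvalue of a union of two equal balls equals the first Dirichlet eigenvalue of one of them.) -/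

import Mathlib

open MeasureTheory Metric Set Filter

open scoped Classical ENNReal

noncomputable section

/-- The Rayleigh quotient of `u : ℝ^d → ℝ`. -/
def rayleigh (d : ℕ) (u : EuclideanSpace ℝ (Fin d) → ℝ) : ℝ :=
  (∫ x, ‖gradient u x‖ ^ 2) / (∫ x, (u x) ^ 2)

/-- A trial function for the Dirichlet eigenvalue on `Ω`: Lipschitz, vanishing outside `Ω`,
and not almost everywhere zero. -/
def IsDirTrial (d : ℕ) (Ω : Set (EuclideanSpace ℝ (Fin d)))
    (u : EuclideanSpace ℝ (Fin d) → ℝ) : Prop :=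
  (∃ K, LipschitzWith K u) ∧ (∀ x ∉ Ω, u x = 0) ∧ ¬ (u =ᵐ[volume] fun _ => (0 : ℝ))

/-- The first Dirichlet eigenvalue of `Ω`. -/
def dirichletEV (d : ℕ) (Ω : Set (EuclideanSpace ℝ (Fin d))) : ℝ :=
  sInf { r | ∃ u, IsDirTrial d Ω u ∧ rayleigh d u = r }

/-- The first twisted eigenvalue of `Ω` with orthogonality constraint `g`. -/
def twistedEV (d : ℕ) (Ω : Set (EuclideanSpace ℝ (Fin d)))
    (g : EuclideanSpace ℝ (Fin d) → ℝ) : ℝ :=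
  sInf { r | ∃ u, IsDirTrial d Ω u ∧ (∫ x, u x * g x) = 0 ∧ rayleigh d u = r }

/-- `u` is a minimizer for the first twisted eigenvalue `λ₁^g(Ω)`. -/
def IsTwistedMin (d : ℕ) (Ω : Set (EuclideanSpace ℝ (Fin d)))
    (g u : EuclideanSpace ℝ (Fin d) → ℝ) : Prop :=
  IsDirTrial d Ω u ∧ (∫ x, u x * g x) = 0 ∧ rayleigh d u = twistedEV d Ω g

/-- The bang-bang function equal to `1` on `Bm` and `α` elsewhere. -/
def chiBang (d : ℕ) (α : ℝ) (Bm : Set (EuclideanSpace ℝ (Fin d))) :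
    EuclideanSpace ℝ (Fin d) → ℝ :=
  fun x => if x ∈ Bm then 1 else α

theorem norm_gradient_eq_norm_fderiv {d : ℕ} (u : EuclideanSpace ℝ (Fin d) → ℝ)
    (x : EuclideanSpace ℝ (Fin d)) : ‖gradient u x‖ = ‖fderiv ℝ u x‖ := by
  simp [gradient]

theorem hasCompactSupport_of_eq_zero_off_ball {d : ℕ} {u : EuclideanSpace ℝ (Fin d) → ℝ}
    {c : EuclideanSpace ℝ (Fin d)} {r : ℝ} (h0 : ∀ x ∉ ball c r, u x = 0) :
    HasCompactSupport u :=
  HasCompactSupport.intro (isCompact_closedBall c r)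
    fun x hx => h0 x fun h => hx (ball_subset_closedBall h)

theorem hasCompactSupport_sq {d : ℕ} {u : EuclideanSpace ℝ (Fin d) → ℝ}
    (hc : HasCompactSupport u) : HasCompactSupport fun x => u x ^ 2 :=
  HasCompactSupport.mono hc fun x hx => by
    intro h
    exact hx (by simp [h])

theorem integrable_sq_of_lipschitz {d : ℕ} {u : EuclideanSpace ℝ (Fin d) → ℝ} {K : NNReal}
    (hu : LipschitzWith K u) (hc : HasCompactSupport u) : Integrable fun x => u x ^ 2 := by
  exact (hu.continuous.pow 2).integrable_of_hasCompactSupport (hasCompactSupport_sq hc)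

theorem integrable_norm_gradient_sq {d : ℕ} {u : EuclideanSpace ℝ (Fin d) → ℝ} {K : NNReal}
    (hu : LipschitzWith K u) (hc : HasCompactSupport u) :
    Integrable fun x => ‖gradient u x‖ ^ 2 := by
  simp only [norm_gradient_eq_norm_fderiv]
  have hsupp : Function.support (fun x => ‖fderiv ℝ u x‖ ^ 2) ⊆ tsupport u := by
    intro x hx
    refine support_fderiv_subset ℝ ?_
    intro h
    exact hx (by simp [h])
  rw [← integrableOn_iff_integrable_of_support_subset hsupp]
  refine Measure.integrableOn_of_bounded (M := (K : ℝ) ^ 2) hc.isCompact.measure_lt_top.ne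
    ((measurable_fderiv ℝ u).norm.pow_const 2).aestronglyMeasurable (ae_of_all _ fun x => ?_)
  rw [Real.norm_of_nonneg (by positivity)]
  gcongr
  exact norm_fderiv_le_of_lipschitz ℝ hu

theorem exists_lipschitzWith_sq {d : ℕ} {u : EuclideanSpace ℝ (Fin d) → ℝ} {K : NNReal}
    (hu : LipschitzWith K u) (hc : HasCompactSupport u) :
    ∃ L, LipschitzWith L fun x => u x ^ 2 := by
  obtain ⟨M, hM⟩ := hc.exists_bound_of_continuous hu.continuous
  have hM0 : 0 ≤ M := (norm_nonneg _).trans (hM 0)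
  refine ⟨Real.toNNReal (2 * M) * K, LipschitzWith.of_dist_le_mul fun x y => ?_⟩
  have h1 : |u x - u y| ≤ K * dist x y := hu.dist_le_mul x y
  have h2 : |u x + u y| ≤ 2 * M := by
    refine (abs_add_le _ _).trans ?_
    have := hM x
    have := hM y
    simp only [Real.norm_eq_abs] at *
    linarith
  rw [Real.dist_eq, show u x ^ 2 - u y ^ 2 = (u x + u y) * (u x - u y) by ring, abs_mul,
    NNReal.coe_mul, Real.coe_toNNReal _ (by positivity), mul_assoc]
  exact mul_le_mul h2 h1 (abs_nonneg _) (by positivity)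

/-- A Poincaré inequality on the unit ball. -/
theorem integral_sq_le_integral_norm_gradient_sq {d : ℕ} (hd : 2 ≤ d)
    {u : EuclideanSpace ℝ (Fin d) → ℝ} {K : NNReal} (hu : LipschitzWith K u)
    (h0 : ∀ x ∉ ball (0 : EuclideanSpace ℝ (Fin d)) 1, u x = 0) :
    ∫ x, u x ^ 2 ≤ 4 * ∫ x, ‖gradient u x‖ ^ 2 := by
  have hc := hasCompactSupport_of_eq_zero_off_ball h0
  have hi1 := integrable_sq_of_lipschitz hu hc
  have hi2 := integrable_norm_gradient_sq hu hc
  obtain ⟨L, hL⟩ := exists_lipschitzWith_sq hu hc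
  have hcs : HasCompactSupport fun x => u x ^ 2 := hasCompactSupport_sq hc
  let e : EuclideanSpace ℝ (Fin d) := EuclideanSpace.single ⟨0, by omega⟩ 1
  have he : ‖e‖ = 1 := by simp [e]
  let f : EuclideanSpace ℝ (Fin d) →L[ℝ] ℝ := innerSL ℝ e
  have hf : ∀ x, |f x| ≤ ‖x‖ := fun x => by
    simpa [f, he] using abs_real_inner_le_norm e x
  have hfe : f e = 1 := by simp [f, he]
  have key := LipschitzWith.integral_lineDeriv_mul_eq (μ := volume) f.lipschitz hL hcs e
  have hl : ∀ x, lineDeriv ℝ f x e = 1 := fun x => by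
    rw [f.differentiableAt.lineDeriv_eq_fderiv, f.fderiv, hfe]
  simp only [hl, one_mul] at key
  have hle : ‖∫ x, lineDeriv ℝ (fun x => u x ^ 2) x (-e) * f x‖ ≤
      ∫ x, (2⁻¹ * u x ^ 2 + 2 * ‖gradient u x‖ ^ 2) := by
    refine norm_integral_le_of_norm_le ((hi1.const_mul _).add (hi2.const_mul _)) ?_
    filter_upwards [hu.ae_differentiableAt (μ := volume)] with x hx
    have hxs : DifferentiableAt ℝ (fun x => u x ^ 2) x := hx.pow 2
    rw [norm_gradient_eq_norm_fderiv, hxs.lineDeriv_eq_fderiv, fderiv_fun_pow 2 hx]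
    by_cases hux : u x = 0
    · simp [hux]
    have hx1 : ‖x‖ < 1 := by
      by_contra h
      exact hux (h0 x (by simpa using h))
    have hfx : |f x| ≤ 1 := (hf x).trans hx1.le
    have hde : |fderiv ℝ u x e| ≤ ‖fderiv ℝ u x‖ := by
      simpa [he] using (fderiv ℝ u x).le_opNorm e
    have habs : ‖((2 • u x ^ (2 - 1)) • fderiv ℝ u x) (-e) * f x‖ =
        2 * |u x| * |fderiv ℝ u x e| * |f x| := by
      simp
    rw [habs]
    have hm : |u x| * |fderiv ℝ u x e| * |f x| ≤ |u x| * ‖fderiv ℝ u x‖ * 1 := by gcongr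
    nlinarith [sq_nonneg (|u x| - 2 * ‖fderiv ℝ u x‖), sq_abs (u x)]
  rw [integral_add (hi1.const_mul _) (hi2.const_mul _), integral_const_mul, integral_const_mul,
    ← key] at hle
  have := (le_abs_self _).trans hle
  linarith

theorem rayleigh_nonneg {d : ℕ} (u : EuclideanSpace ℝ (Fin d) → ℝ) : 0 ≤ rayleigh d u :=
  div_nonneg (integral_nonneg fun _ => by positivity) (integral_nonneg fun _ => by positivity)

theorem integral_sq_pos {d : ℕ} {u : EuclideanSpace ℝ (Fin d) → ℝ}
    {c : EuclideanSpace ℝ (Fin d)} {r : ℝ} (hu : IsDirTrial d (ball c r) u) :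
    0 < ∫ x, u x ^ 2 := by
  obtain ⟨⟨K, hK⟩, h0, hne⟩ := hu
  have hi := integrable_sq_of_lipschitz hK (hasCompactSupport_of_eq_zero_off_ball h0)
  refine (integral_nonneg fun _ => by positivity).lt_of_ne' fun h => hne ?_
  rw [integral_eq_zero_iff_of_nonneg (fun _ => by positivity) hi] at h
  filter_upwards [h] with x hx
  simpa using hx

theorem exists_isDirTrial_unit_ball (d : ℕ) :
    ∃ u, IsDirTrial d (ball (0 : EuclideanSpace ℝ (Fin d)) 1) u := by
  have hlip : LipschitzWith 1 fun x : EuclideanSpace ℝ (Fin d) => max (1 - ‖x‖) 0 := by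
    refine LipschitzWith.max_const (LipschitzWith.of_dist_le_mul fun x y => ?_) 0
    simpa [Real.dist_eq, abs_sub_comm, dist_eq_norm] using abs_norm_sub_norm_le x y
  refine ⟨fun x => max (1 - ‖x‖) 0, ⟨1, hlip⟩, fun x hx => ?_, fun h => ?_⟩
  · simpa using hx
  · have := congrFun ((hlip.continuous.ae_eq_iff_eq volume continuous_const).1 h) 0
    simp at this

theorem dirichletEV_unit_ball_pos {d : ℕ} (hd : 2 ≤ d) :
    0 < dirichletEV d (ball (0 : EuclideanSpace ℝ (Fin d)) 1) := by
  refine lt_of_lt_of_le (show (0 : ℝ) < 1 / 4 by norm_num) (le_csInf ?_ ?_)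
  · obtain ⟨u, hu⟩ := exists_isDirTrial_unit_ball d
    exact ⟨_, u, hu, rfl⟩
  · rintro _ ⟨u, hu, rfl⟩
    have hpos := integral_sq_pos hu
    obtain ⟨⟨K, hK⟩, h0, -⟩ := hu
    rw [rayleigh, le_div_iff₀ hpos]
    linarith [integral_sq_le_integral_norm_gradient_sq hd hK h0]

theorem integral_comp_inv_smul_sub {d : ℕ} (g : EuclideanSpace ℝ (Fin d) → ℝ)
    (c : EuclideanSpace ℝ (Fin d)) {r : ℝ} (hr : 0 < r) :
    ∫ x, g (r⁻¹ • (x - c)) = r ^ d * ∫ x, g x := by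
  rw [integral_sub_right_eq_self (fun x => g (r⁻¹ • x)) c,
    Measure.integral_comp_inv_smul_of_nonneg _ _ hr.le, finrank_euclideanSpace_fin, smul_eq_mul]

theorem norm_gradient_rescale {d : ℕ} (φ : EuclideanSpace ℝ (Fin d) → ℝ)
    (c x : EuclideanSpace ℝ (Fin d)) (a r : ℝ) :
    ‖gradient (fun x => a * φ (r⁻¹ • (x - c))) x‖ ^ 2 =
      a ^ 2 * r⁻¹ ^ 2 * ‖gradient φ (r⁻¹ • (x - c))‖ ^ 2 := by
  have h : fderiv ℝ (fun x => a * φ (r⁻¹ • (x - c))) x =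
      a • r⁻¹ • fderiv ℝ φ (r⁻¹ • (x - c)) := by
    have h1 : (fun x => a * φ (r⁻¹ • (x - c))) = a • fun x => φ (r⁻¹ • (x - c)) := rfl
    rw [h1, fderiv_const_smul_field, Pi.smul_apply, fderiv_comp_sub (f := fun x => φ (r⁻¹ • x)),
      fderiv_comp_smul]
  rw [norm_gradient_eq_norm_fderiv, norm_gradient_eq_norm_fderiv, h, norm_smul, norm_smul,
    mul_pow, mul_pow, Real.norm_eq_abs, Real.norm_eq_abs, sq_abs, sq_abs, mul_assoc]

theorem lipschitzWith_rescale {d : ℕ} {φ : EuclideanSpace ℝ (Fin d) → ℝ} {K : NNReal}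
    (hφ : LipschitzWith K φ) (c : EuclideanSpace ℝ (Fin d)) (a r : ℝ) :
    LipschitzWith (‖a‖₊ * (K * (‖r⁻¹‖₊ * (1 + 0)))) fun x => a * φ (r⁻¹ • (x - c)) :=
  (lipschitzWith_smul a).comp (hφ.comp ((lipschitzWith_smul r⁻¹).comp
    (LipschitzWith.id.sub (LipschitzWith.const c))))

theorem rescale_eq_zero_off_ball {d : ℕ} {φ : EuclideanSpace ℝ (Fin d) → ℝ}
    (h0 : ∀ x ∉ ball (0 : EuclideanSpace ℝ (Fin d)) 1, φ x = 0)
    (c : EuclideanSpace ℝ (Fin d)) (a : ℝ) {r : ℝ} (hr : 0 < r) :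
    ∀ x ∉ ball c r, a * φ (r⁻¹ • (x - c)) = 0 := by
  intro x hx
  rw [h0, mul_zero]
  simp only [mem_ball, dist_eq_norm, not_lt, sub_zero] at hx ⊢
  rw [norm_smul, norm_inv, Real.norm_of_nonneg hr.le, inv_mul_eq_div, le_div_iff₀ hr]
  linarith

theorem eventuallyEq_zero_of_notMem_closedBall {d : ℕ} {v : EuclideanSpace ℝ (Fin d) → ℝ}
    {c x : EuclideanSpace ℝ (Fin d)} {r : ℝ} (h0 : ∀ x ∉ ball c r, v x = 0)
    (hx : x ∉ closedBall c r) : v =ᶠ[nhds x] fun _ => 0 := by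
  filter_upwards [isClosed_closedBall.isOpen_compl.mem_nhds hx] with y hy
  exact h0 y fun h => hy (ball_subset_closedBall h)

theorem norm_gradient_add_sq {d : ℕ} {v w : EuclideanSpace ℝ (Fin d) → ℝ}
    {c c' : EuclideanSpace ℝ (Fin d)} {r r' : ℝ} (hv : ∀ x ∉ ball c r, v x = 0)
    (hw : ∀ x ∉ ball c' r', w x = 0) (hd : Disjoint (closedBall c r) (closedBall c' r'))
    (x : EuclideanSpace ℝ (Fin d)) :
    ‖gradient (fun x => v x + w x) x‖ ^ 2 = ‖gradient v x‖ ^ 2 + ‖gradient w x‖ ^ 2 := by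
  simp only [norm_gradient_eq_norm_fderiv]
  by_cases hx : x ∈ closedBall c r
  · have h := eventuallyEq_zero_of_notMem_closedBall hw (disjoint_left.1 hd hx)
    have h1 : (fun x => v x + w x) =ᶠ[nhds x] v := by
      filter_upwards [h] with y hy
      simp [hy]
    rw [h1.fderiv_eq, h.fderiv_eq]
    simp
  · have h := eventuallyEq_zero_of_notMem_closedBall hv hx
    have h1 : (fun x => v x + w x) =ᶠ[nhds x] w := by
      filter_upwards [h] with y hy
      simp [hy]
    rw [h1.fderiv_eq, h.fderiv_eq]
    simp

theorem inv_rpow_sq_le {d : ℕ} (hd : 2 ≤ d) {y : ℝ} (hy : 0 < y) :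
    y * (y ^ ((1 : ℝ) / d))⁻¹ ^ 2 ≤ y + 2 / d * (1 - y) := by
  have hd' : (2 : ℝ) ≤ d := by exact_mod_cast hd
  have hyi : 0 < y⁻¹ := inv_pos.2 hy
  have h1 : (y ^ ((1 : ℝ) / d))⁻¹ ^ 2 = (1 + (y⁻¹ - 1)) ^ ((2 : ℝ) / d) := by
    rw [← Real.inv_rpow hy.le, ← Real.rpow_natCast, ← Real.rpow_mul hyi.le]
    congr 1
    · ring
    · push_cast
      ring
  have h2 : (1 + (y⁻¹ - 1)) ^ ((2 : ℝ) / d) ≤ 1 + 2 / d * (y⁻¹ - 1) :=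
    rpow_one_add_le_one_add_mul_self (by linarith) (by positivity)
      ((div_le_one (by linarith)).2 hd')
  calc y * (y ^ ((1 : ℝ) / d))⁻¹ ^ 2 ≤ y * (1 + 2 / d * (y⁻¹ - 1)) := by
        rw [h1]
        gcongr
    _ = y + 2 / d * (1 - y) := by
        field_simp

theorem exists_radii {d : ℕ} (hd : 2 ≤ d) {α : ℝ} (hα0 : 0 < α) (hα1 : α < 1) :
    ∃ s t b : ℝ, 0 < s ∧ 0 < t ∧ 0 < b ∧ t ^ d < s ^ d ∧ s ^ d + t ^ d = 2 ∧
      α * s ^ d = b * t ^ d ∧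
      s ^ d * s⁻¹ ^ 2 + b ^ 2 * (t ^ d * t⁻¹ ^ 2) < s ^ d + b ^ 2 * t ^ d := by
  obtain ⟨ε, hε0, hε1, hε⟩ : ∃ ε : ℝ, 0 < ε ∧ ε < 1 ∧ α * (1 + ε) < 1 - ε :=
    ⟨(1 - α) / 4, by linarith, by linarith, by nlinarith⟩
  have hpow : ∀ y : ℝ, 0 < y → (y ^ ((1 : ℝ) / d)) ^ d = y := fun y hy => by
    rw [one_div, Real.rpow_inv_natCast_pow hy.le (by omega)]
  have hy1 : 0 < 1 + ε := by linarith
  have hy2 : 0 < 1 - ε := by linarith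
  have hb0 : 0 < α * (1 + ε) / (1 - ε) := by positivity
  have hb1 : α * (1 + ε) / (1 - ε) < 1 := (div_lt_one hy2).2 hε
  refine ⟨(1 + ε) ^ ((1 : ℝ) / d), (1 - ε) ^ ((1 : ℝ) / d), α * (1 + ε) / (1 - ε),
    Real.rpow_pos_of_pos hy1 _, Real.rpow_pos_of_pos hy2 _, hb0, ?_⟩
  rw [hpow _ hy1, hpow _ hy2]
  refine ⟨by linarith, by ring, by field_simp, ?_⟩
  have h1 := inv_rpow_sq_le hd hy1
  have h2 := inv_rpow_sq_le hd hy2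
  set b := α * (1 + ε) / (1 - ε)
  have hd0 : (0 : ℝ) < d := by exact_mod_cast (by omega : 0 < d)
  have h3 := mul_le_mul_of_nonneg_left h2 (sq_nonneg b)
  have h4 : 0 < 2 / (d : ℝ) * ε * (1 - b ^ 2) := by
    have : 0 < 1 - b ^ 2 := by nlinarith
    positivity
  nlinarith

/-- Gluing two rescaled copies of a trial function on the unit ball. -/
theorem twistedEV_two_balls_le {d : ℕ} {α s t b : ℝ} (hs : 0 < s) (ht : 0 < t)
    (hb : α * s ^ d = b * t ^ d) {c c' : EuclideanSpace ℝ (Fin d)}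
    (hdisj : Disjoint (closedBall c s) (closedBall c' t)) {φ : EuclideanSpace ℝ (Fin d) → ℝ}
    (hφ : IsDirTrial d (ball 0 1) φ) :
    twistedEV d (ball c s ∪ ball c' t) (chiBang d α (ball c' t)) ≤
      (s ^ d * s⁻¹ ^ 2 + b ^ 2 * (t ^ d * t⁻¹ ^ 2)) / (s ^ d + b ^ 2 * t ^ d) *
        rayleigh d φ := by
  have hpos := integral_sq_pos hφ
  obtain ⟨⟨K, hK⟩, h0, -⟩ := hφ
  have hD : 0 < s ^ d + b ^ 2 * t ^ d := by positivity
  set v := fun x => 1 * φ (s⁻¹ • (x - c))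
  set w := fun x => (-b) * φ (t⁻¹ • (x - c'))
  have hvL := lipschitzWith_rescale hK c 1 s
  have hwL := lipschitzWith_rescale hK c' (-b) t
  have hv0 : ∀ x ∉ ball c s, v x = 0 := rescale_eq_zero_off_ball h0 c 1 hs
  have hw0 : ∀ x ∉ ball c' t, w x = 0 := rescale_eq_zero_off_ball h0 c' (-b) ht
  have hvc := hasCompactSupport_of_eq_zero_off_ball hv0
  have hwc := hasCompactSupport_of_eq_zero_off_ball hw0
  have hballs : Disjoint (ball c s) (ball c' t) :=
    hdisj.mono ball_subset_closedBall ball_subset_closedBall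
  have hvw : ∀ x, v x = 0 ∨ w x = 0 := fun x => by
    by_cases hx : x ∈ ball c s
    · exact Or.inr (hw0 x (disjoint_left.1 hballs hx))
    · exact Or.inl (hv0 x hx)
  have hsq : ∫ x, (v x + w x) ^ 2 = (s ^ d + b ^ 2 * t ^ d) * ∫ x, φ x ^ 2 := by
    have : ∀ x, (v x + w x) ^ 2 = v x ^ 2 + w x ^ 2 := fun x => by
      rcases hvw x with h | h <;> simp [h]
    simp only [this]
    rw [integral_add (integrable_sq_of_lipschitz hvL hvc) (integrable_sq_of_lipschitz hwL hwc)]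
    simp only [mul_pow, integral_const_mul,
      integral_comp_inv_smul_sub (fun x => φ x ^ 2) _ hs,
      integral_comp_inv_smul_sub (fun x => φ x ^ 2) _ ht]
    ring
  have hgr : ∫ x, ‖gradient (fun x => v x + w x) x‖ ^ 2 =
      (s ^ d * s⁻¹ ^ 2 + b ^ 2 * (t ^ d * t⁻¹ ^ 2)) * ∫ x, ‖gradient φ x‖ ^ 2 := by
    simp only [norm_gradient_add_sq hv0 hw0 hdisj]
    rw [integral_add (integrable_norm_gradient_sq hvL hvc) (integrable_norm_gradient_sq hwL hwc)]
    simp only [norm_gradient_rescale, integral_const_mul,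
      integral_comp_inv_smul_sub (fun x => ‖gradient φ x‖ ^ 2) _ hs,
      integral_comp_inv_smul_sub (fun x => ‖gradient φ x‖ ^ 2) _ ht]
    ring
  have horth : ∫ x, (v x + w x) * chiBang d α (ball c' t) x = 0 := by
    have : ∀ x, (v x + w x) * chiBang d α (ball c' t) x = α * v x + w x := fun x => by
      by_cases hx : x ∈ ball c' t
      · simp [chiBang, hx, hv0 x (disjoint_right.1 hballs hx)]
      · simp [chiBang, hx, hw0 x hx, mul_comm]
    simp only [this]
    rw [integral_add ((hvL.continuous.integrable_of_hasCompactSupport hvc).const_mul α)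
      (hwL.continuous.integrable_of_hasCompactSupport hwc), integral_const_mul]
    simp only [integral_const_mul, integral_comp_inv_smul_sub φ _ hs,
      integral_comp_inv_smul_sub φ _ ht]
    linear_combination (∫ x, φ x) * hb
  refine csInf_le ⟨0, ?_⟩ ⟨fun x => v x + w x, ⟨⟨_, hvL.add hwL⟩, ?_, ?_⟩, horth, ?_⟩
  · rintro _ ⟨u, -, -, rfl⟩
    exact rayleigh_nonneg u
  · intro x hx
    rw [mem_union, not_or] at hx
    change v x + w x = 0
    rw [hv0 x hx.1, hw0 x hx.2, add_zero]
  · intro h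
    have h1 : ∫ x, (v x + w x) ^ 2 = 0 := by
      rw [integral_eq_zero_of_ae]
      filter_upwards [h] with x hx
      simp [hx]
    rw [hsq] at h1
    exact (mul_pos hD hpos).ne' h1
  · rw [rayleigh, rayleigh, hsq, hgr, mul_div_mul_comm]

theorem volume_ball_eq {d : ℕ} (c : EuclideanSpace ℝ (Fin d)) {r : ℝ} (hr : 0 < r) :
    volume (ball c r) =
      ENNReal.ofReal (r ^ d) * volume (ball (0 : EuclideanSpace ℝ (Fin d)) 1) := by
  rw [Measure.addHaar_ball_of_pos _ _ hr, finrank_euclideanSpace_fin]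

/-- for `α < 1` there are two disjoint balls of different measures whose scaled
twisted eigenvalue is strictly below the Hong–Krahn–Szegő value `2^{2/d}|B|^{2/d}λ₁(B)`. -/
theorem stmt11 (d : ℕ) (hd : 2 ≤ d) (α : ℝ) (hα0 : 0 < α) (hα1 : α < 1) :
    ∃ (cp cm : EuclideanSpace ℝ (Fin d)) (rp rm : ℝ), 0 < rp ∧ 0 < rm ∧
      Disjoint (ball cp rp) (ball cm rm) ∧
      volume (ball cm rm) < volume (ball cp rp) ∧
      (volume (ball cp rp ∪ ball cm rm)).toReal ^ ((2 : ℝ) / d) *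
          twistedEV d (ball cp rp ∪ ball cm rm) (chiBang d α (ball cm rm)) <
        (2 : ℝ) ^ ((2 : ℝ) / d) *
          ((volume (ball (0 : EuclideanSpace ℝ (Fin d)) 1)).toReal ^ ((2 : ℝ) / d) *
            dirichletEV d (ball (0 : EuclideanSpace ℝ (Fin d)) 1)) := by
  obtain ⟨s, t, b, hs, ht, hb, hlt, hsum, hbal, hN⟩ := exists_radii hd hα0 hα1
  set lam := dirichletEV d (ball (0 : EuclideanSpace ℝ (Fin d)) 1)
  have hlam0 : 0 < lam := dirichletEV_unit_ball_pos hd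
  let e : EuclideanSpace ℝ (Fin d) := EuclideanSpace.single ⟨0, by omega⟩ (s + t + 1)
  have he : ‖e‖ = s + t + 1 := by
    simp only [e, PiLp.norm_single, Real.norm_eq_abs]
    exact abs_of_pos (by positivity)
  have hdisj : Disjoint (closedBall (0 : EuclideanSpace ℝ (Fin d)) s) (closedBall e t) :=
    closedBall_disjoint_closedBall (by rw [dist_zero_left, he]; linarith)
  have hballs : Disjoint (ball (0 : EuclideanSpace ℝ (Fin d)) s) (ball e t) :=
    hdisj.mono ball_subset_closedBall ball_subset_closedBall
  set V := volume (ball (0 : EuclideanSpace ℝ (Fin d)) 1)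
  have hV0 : V ≠ 0 := (measure_ball_pos volume _ one_pos).ne'
  have hVt : V ≠ ⊤ := measure_ball_lt_top.ne
  refine ⟨0, e, s, t, hs, ht, hballs, ?_, ?_⟩
  · rw [volume_ball_eq _ hs, volume_ball_eq _ ht]
    refine (ENNReal.mul_lt_mul_iff_left hV0 hVt).2 ?_
    exact (ENNReal.ofReal_lt_ofReal_iff (by positivity)).2 hlt
  · have hvol : (volume (ball (0 : EuclideanSpace ℝ (Fin d)) s ∪ ball e t)).toReal =
        2 * V.toReal := by
      rw [measure_union hballs measurableSet_ball, volume_ball_eq _ hs, volume_ball_eq _ ht,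
        ← add_mul, ← ENNReal.ofReal_add (by positivity) (by positivity), hsum,
        ENNReal.toReal_mul, ENNReal.toReal_ofReal (by norm_num)]
    have hVr : 0 < V.toReal := ENNReal.toReal_pos hV0 hVt
    rw [hvol, Real.mul_rpow (by norm_num) hVr.le, mul_assoc]
    have hN0 : 0 < s ^ d * s⁻¹ ^ 2 + b ^ 2 * (t ^ d * t⁻¹ ^ 2) := by positivity
    have hD0 : 0 < s ^ d + b ^ 2 * t ^ d := by positivity
    obtain ⟨_, ⟨φ, hφ, rfl⟩, hφlt⟩ : ∃ r ∈ {r | ∃ u, IsDirTrial d (ball 0 1) u ∧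
        rayleigh d u = r}, r < lam / ((s ^ d * s⁻¹ ^ 2 + b ^ 2 * (t ^ d * t⁻¹ ^ 2)) /
          (s ^ d + b ^ 2 * t ^ d)) := by
      refine exists_lt_of_csInf_lt ?_ ?_
      · obtain ⟨u, hu⟩ := exists_isDirTrial_unit_ball d
        exact ⟨_, u, hu, rfl⟩
      · change lam < _
        rw [lt_div_iff₀ (by positivity)]
        exact mul_lt_of_lt_one_right hlam0 ((div_lt_one hD0).2 hN)
    rw [lt_div_iff₀' (by positivity)] at hφlt
    have hlt' := (twistedEV_two_balls_le hs ht hbal hdisj hφ).trans_lt hφlt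
    gcongr
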